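/- Tail control via Markov chain mixing (Lemma): Assume A6 (for some ν > 2) and A9, and suppose there exist α̃ ∈ [0,1) and C̃ > 0 such that ‖E[φ(K^m_ψ(x))] − E_{Y ~ p_ψ}[φ(Y)]‖ ≤ C̃ α̃^m for all ψ ∈ Ψ and x ∈ X. Then for every Ψ-valued random variable θ (possibly depending on X_1, …, X_n), inf_{ϵ>0} ε_{n;ν}(θ; ϵ) ≤ (1 + 2^{(ν−2)/(2ν)} κ_{ν;m} C̃^{(ν−2)/(2ν)}) · α̃^{(ν−2)m/(3ν−2)}. -/

import Mathlib

open MeasureTheory ProbabilityTheory Filter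
open scoped ENNReal NNReal RealInnerProductSpace ProbabilityTheory Topology

noncomputable section

namespace CD

abbrev Vec (p : ℕ) := EuclideanSpace ℝ (Fin p)

/-- `m`-fold iterate of a Markov kernel. -/
def kIter {X : Type*} [MeasurableSpace X] (κ : Kernel X X) : ℕ → Kernel X X
  | 0 => Kernel.id
  | m + 1 => κ ∘ₖ kIter κ m

/-- Partition function of an unnormalized exponential family. -/
def Zfn {X : Type*} [MeasurableSpace X] {p : ℕ} (c : Measure X) (φ : X → Vec p)
    (ψ : Vec p) : ℝ≥0∞ :=
  ∫⁻ x, ENNReal.ofReal (Real.exp ⟪ψ, φ x⟫) ∂c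

/-- The exponential family member `p_ψ`. -/
def expMeas {X : Type*} [MeasurableSpace X] {p : ℕ} (c : Measure X) (φ : X → Vec p)
    (ψ : Vec p) : Measure X :=
  (Zfn c φ ψ)⁻¹ • c.withDensity fun x => ENNReal.ofReal (Real.exp ⟪ψ, φ x⟫)

/-- Log-partition function. -/
def logZ {X : Type*} [MeasurableSpace X] {p : ℕ} (c : Measure X) (φ : X → Vec p)
    (ψ : Vec p) : ℝ :=
  Real.log (Zfn c φ ψ).toReal

/-- Quadratic form of the Hessian of `g` at `ψ`. -/
def hessQ {p : ℕ} (g : Vec p → ℝ) (ψ v : Vec p) : ℝ :=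
  iteratedFDeriv ℝ 2 g ψ ![v, v]

/-- Smallest eigenvalue of the Hessian of `g` at `ψ`. -/
def lamMin {p : ℕ} (g : Vec p → ℝ) (ψ : Vec p) : ℝ :=
  sInf ((fun v => hessQ g ψ v) '' {v : Vec p | ‖v‖ = 1})

/-- Largest eigenvalue of the Hessian of `g` at `ψ`. -/
def lamMax {p : ℕ} (g : Vec p → ℝ) (ψ : Vec p) : ℝ :=
  sSup ((fun v => hessQ g ψ v) '' {v : Vec p | ‖v‖ = 1})

/-- Trace of the Hessian of `g` at `ψ`. -/
def hessTr {p : ℕ} (g : Vec p → ℝ) (ψ : Vec p) : ℝ :=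
  ∑ i : Fin p, hessQ g ψ (EuclideanSpace.single i 1)

/-- `μ := min_{ψ ∈ Ψ} λ_min (∇² log Z (ψ))`. -/
def muC {X : Type*} [MeasurableSpace X] {p : ℕ} (c : Measure X) (φ : X → Vec p)
    (Ψ : Set (Vec p)) : ℝ :=
  sInf (lamMin (logZ c φ) '' Ψ)

/-- `L := max_{ψ ∈ Ψ} λ_max (∇² log Z (ψ))`. -/
def LC {X : Type*} [MeasurableSpace X] {p : ℕ} (c : Measure X) (φ : X → Vec p)
    (Ψ : Set (Vec p)) : ℝ :=
  sSup (lamMax (logZ c φ) '' Ψ)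

/-- `σ² := sup_{ψ ∈ Ψ} tr (∇² log Z (ψ))`. -/
def sigSq {X : Type*} [MeasurableSpace X] {p : ℕ} (c : Measure X) (φ : X → Vec p)
    (Ψ : Set (Vec p)) : ℝ :=
  sSup (hessTr (logZ c φ) '' Ψ)

/-- Chi-squared divergence `χ²(P, Q) = ∫ (dP/dQ − 1)² dQ`. -/
def chi2 {X : Type*} [MeasurableSpace X] (P Q : Measure X) : ℝ :=
  ∫ x, ((P.rnDeriv Q x).toReal - 1) ^ 2 ∂Q

/-- The test functions `{φ_i} ∪ {φ_i φ_j}` of Assumption A5. -/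
def testFuns {X : Type*} {p : ℕ} (φ : X → Vec p) : Set (X → ℝ) :=
  {f | ∃ i : Fin p, f = fun x => φ x i} ∪ {f | ∃ i j : Fin p, f = fun x => φ x i * φ x j}

/-- Assumption A1: regular minimal exponential family, `Ψ` convex compact inside the
natural domain, true parameter interior. -/
structure A1 {X : Type*} [MeasurableSpace X] {p : ℕ} (c : Measure X) (φ : X → Vec p)
    (Ψ : Set (Vec p)) (ψstar : Vec p) : Prop where
  measφ : Measurable φ
  cNe : c ≠ 0
  domOpen : IsOpen {ψ : Vec p | Zfn c φ ψ < ∞}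
  minimal : ∀ a : Vec p, (∃ r : ℝ, ∀ᵐ x ∂c, ⟪a, φ x⟫ = r) → a = 0
  convexΨ : Convex ℝ Ψ
  compactΨ : IsCompact Ψ
  subD : ∀ ψ ∈ Ψ, Zfn c φ ψ < ∞
  star_mem : ψstar ∈ interior Ψ

/-- Assumption A4: chi-square control. -/
structure A4 {X : Type*} [MeasurableSpace X] {p : ℕ} (c : Measure X) (φ : X → Vec p)
    (Ψ : Set (Vec p)) (ψstar : Vec p) (Cχ : ℝ) : Prop where
  pos : 0 < Cχ
  ac : ∀ ψ ∈ Ψ, expMeas c φ ψstar ≪ expMeas c φ ψ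
  bound : ∀ ψ ∈ Ψ, chi2 (expMeas c φ ψstar) (expMeas c φ ψ) ≤ Cχ ^ 2 * ‖ψ - ψstar‖ ^ 2

/-- Assumption A5: invariant Markov kernels with a restricted spectral gap `α < 1`. -/
structure A5 {X : Type*} [MeasurableSpace X] {p : ℕ} (c : Measure X) (φ : X → Vec p)
    (Ψ : Set (Vec p)) (k : Vec p → Kernel X X) (α : ℝ) : Prop where
  markov : ∀ ψ, IsMarkovKernel (k ψ)
  nonneg : 0 ≤ α
  lt_one : α < 1
  invariant : ∀ ψ ∈ Ψ, Measure.bind (expMeas c φ ψ) (fun x => k ψ x) = expMeas c φ ψ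
  contract : ∀ ψ ∈ Ψ, ∀ f ∈ testFuns φ,
    (∫ x, (∫ y, (f y - ∫ z, f z ∂(expMeas c φ ψ)) ∂(k ψ x)) ^ 2 ∂(expMeas c φ ψ)) ≤
      α ^ 2 * ∫ x, (f x - ∫ z, f z ∂(expMeas c φ ψ)) ^ 2 ∂(expMeas c φ ψ)

/-- σ-algebra generated by `f 1, …, f t`. -/
def histSup {Ω X : Type*} [MeasurableSpace X] (f : ℕ → Ω → X) (t : ℕ) :
    MeasurableSpace Ω :=
  ⨆ s ∈ Set.Icc 1 t, MeasurableSpace.comap (f s) inferInstance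

/-- The online contrastive divergence algorithm with `m` Markov steps, step sizes `η`,
data `Xd`, Markov-chain samples `Xt` and iterates `ψit`. -/
structure OnlineCD {X : Type*} [MeasurableSpace X] {p : ℕ} (φ : X → Vec p)
    (Ψ : Set (Vec p)) (k : Vec p → Kernel X X) (m : ℕ) {Ω : Type*} [MeasurableSpace Ω]
    (P : Measure Ω) (pstar : Measure X) (n : ℕ) (η : ℕ → ℝ) (Xd Xt : ℕ → Ω → X)
    (ψit : ℕ → Ω → Vec p) (proj : Vec p → Vec p) : Prop where
  measXd : ∀ t, Measurable (Xd t)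
  measXt : ∀ t, Measurable (Xt t)
  projMem : ∀ v, proj v ∈ Ψ
  projDist : ∀ v, ∀ w ∈ Ψ, dist v (proj v) ≤ dist v w
  projMeas : Measurable proj
  init : ∃ ψ₀ ∈ Ψ, ψit 0 = fun _ => ψ₀
  law : ∀ t, 1 ≤ t → t ≤ n → Measure.map (Xd t) P = pstar
  indep : ∀ t, 1 ≤ t → t ≤ n →
    Indep (MeasurableSpace.comap (Xd t) inferInstance)
      (histSup Xd (t - 1) ⊔ histSup Xt (t - 1)) P
  cond : ∀ t, 1 ≤ t → t ≤ n → ∀ A : Set Ω,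
    MeasurableSet[histSup Xd t ⊔ histSup Xt (t - 1)] A →
    ∀ B : Set X, MeasurableSet B →
      P (A ∩ Xt t ⁻¹' B) = ∫⁻ ω in A, kIter (k (ψit (t - 1) ω)) m (Xd t ω) B ∂P
  recur : ∀ t, 1 ≤ t → t ≤ n →
    ψit t = fun ω => proj (ψit (t - 1) ω - η t • (φ (Xd t ω) - φ (Xt t ω)))


/-- Mean of `φ` after `m` steps of the kernel `k ψ` started at `x`:
`g_ψ(x) = E[φ(K^m_ψ(x))]`. -/
def kMean {X : Type*} [MeasurableSpace X] {p : ℕ} (k : Vec p → Kernel X X)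
    (φ : X → Vec p) (m : ℕ) (ψ : Vec p) (x : X) : Vec p :=
  ∫ y, φ y ∂((kIter (k ψ) m) x)

/-- `ḡ(ψ) = E[g_ψ(X₁)]` where `X₁ ~ pstar`. -/
def gBar {X : Type*} [MeasurableSpace X] {p : ℕ} (k : Vec p → Kernel X X)
    (φ : X → Vec p) (m : ℕ) (pstar : Measure X) (ψ : Vec p) : Vec p :=
  ∫ x, kMean k φ m ψ x ∂pstar

/-- Assumption A6: uniform (over starting points and parameters) `ν`-th moment bound
`sup_x sup_{ψ∈Ψ} (E‖φ(K^m_ψ(x)) − E[φ(K^m_ψ(x))]‖^ν)^{1/ν} ≤ κ`. -/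
def A6 {X : Type*} [MeasurableSpace X] {p : ℕ} (φ : X → Vec p) (Ψ : Set (Vec p))
    (k : Vec p → Kernel X X) (m : ℕ) (ν κ : ℝ) : Prop :=
  ∀ x : X, ∀ ψ ∈ Ψ,
    (∫ y, ‖φ y - kMean k φ m ψ x‖ ^ ν ∂((kIter (k ψ) m) x)) ≤ κ ^ ν

/-- Assumption A7: Lipschitz dependence of `g_ψ(x) = E[φ(K^m_ψ(x))]` on `ψ`. -/
def A7 {X : Type*} [MeasurableSpace X] {p : ℕ} (φ : X → Vec p) (Ψ : Set (Vec p))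
    (k : Vec p → Kernel X X) (m : ℕ) (Cm : ℝ) : Prop :=
  ∀ ψ₁ ∈ Ψ, ∀ ψ₂ ∈ Ψ, ∀ x : X,
    ‖kMean k φ m ψ₁ x - kMean k φ m ψ₂ x‖ ≤ Cm * ‖ψ₁ - ψ₂‖

/-- Assumption A8: subexponential tail of `φ(K^m_{ψ*}(X₁))`. -/
def A8 {X : Type*} [MeasurableSpace X] {p : ℕ} (φ : X → Vec p)
    (k : Vec p → Kernel X X) (m : ℕ) (ψstar : Vec p) (pstar : Measure X)
    (σm ζm : ℝ) : Prop :=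
  ∀ z : Vec p, ‖z‖ ≤ ζm →
    (∫ x, (∫ y, Real.exp ⟪z, φ y - gBar k φ m pstar ψstar⟫ ∂((kIter (k ψstar) m) x))
        ∂pstar) ≤ Real.exp (σm ^ 2 * ‖z‖ ^ 2 / 2)

/-- Assumption A9: `ν`-th moment bound for `φ(K^m_ψ(X₁))`, `X₁ ~ pstar`. -/
def A9 {X : Type*} [MeasurableSpace X] {p : ℕ} (φ : X → Vec p) (Ψ : Set (Vec p))
    (k : Vec p → Kernel X X) (m : ℕ) (pstar : Measure X) (ν κ : ℝ) : Prop :=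
  ∀ ψ ∈ Ψ,
    (∫ x, (∫ y, ‖φ y - gBar k φ m pstar ψ‖ ^ ν ∂((kIter (k ψ) m) x)) ∂pstar) ≤ κ ^ ν

/-- The data-iterate correlation quantity
`Δ(θ) = ‖(1/n) Σ_i g_θ(X_i) − ḡ(θ)‖`. -/
def DeltaFn {X : Type*} [MeasurableSpace X] {p n : ℕ} {Ω : Type*}
    (k : Vec p → Kernel X X) (φ : X → Vec p) (m : ℕ) (pstar : Measure X)
    (Xd : Fin n → Ω → X) (θ : Ω → Vec p) (ω : Ω) : ℝ :=
  ‖(n : ℝ)⁻¹ • ∑ i, kMean k φ m (θ ω) (Xd i ω) - gBar k φ m pstar (θ ω)‖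

/-- `ε_{n;ν}(θ; ϵ) = (ϵ² + κ² P(Δ(θ) > ϵ)^{(ν−2)/ν})^{1/2}`. -/
def epsFn {X : Type*} [MeasurableSpace X] {p n : ℕ} {Ω : Type*} [MeasurableSpace Ω]
    (k : Vec p → Kernel X X) (φ : X → Vec p) (m : ℕ) (pstar : Measure X)
    (Xd : Fin n → Ω → X) (P : Measure Ω) (ν κ : ℝ) (θ : Ω → Vec p) (ϵ : ℝ) : ℝ :=
  Real.sqrt (ϵ ^ 2 +
    κ ^ 2 * (P {ω | ϵ < DeltaFn k φ m pstar Xd θ ω}).toReal ^ ((ν - 2) / ν))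

/-- `sup_{0 ≤ t ≤ T−1} P(Δ(ψ_t) > ϵ)` for the offline CD iterates. -/
def tailSup {X : Type*} [MeasurableSpace X] {p n : ℕ} {Ω : Type*} [MeasurableSpace Ω]
    (k : Vec p → Kernel X X) (φ : X → Vec p) (m : ℕ) (pstar : Measure X)
    (Xd : Fin n → Ω → X) (P : Measure Ω) (ψit : ℕ → Ω → Vec p) (T : ℕ) (ϵ : ℝ) : ℝ :=
  sSup {r : ℝ | ∃ t, t < T ∧
    r = (P {ω | ϵ < DeltaFn k φ m pstar Xd (ψit t) ω}).toReal}

/-- The offline (full-batch, constant step size `C`) contrastive divergence algorithm. -/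
structure OfflineCD {X : Type*} [MeasurableSpace X] {p : ℕ} (φ : X → Vec p)
    (Ψ : Set (Vec p)) (k : Vec p → Kernel X X) (m : ℕ) {Ω : Type*} [MeasurableSpace Ω]
    (P : Measure Ω) (pstar : Measure X) (n : ℕ) (C : ℝ) (Xd : Fin n → Ω → X)
    (Xt : ℕ → Fin n → Ω → X) (ψit : ℕ → Ω → Vec p) (proj : Vec p → Vec p) : Prop where
  measXd : ∀ i, Measurable (Xd i)
  measXt : ∀ t i, Measurable (Xt t i)
  measInit : Measurable (ψit 0)
  initMem : ∀ ω, ψit 0 ω ∈ Ψ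
  projMem : ∀ v, proj v ∈ Ψ
  projDist : ∀ v, ∀ w ∈ Ψ, dist v (proj v) ≤ dist v w
  projMeas : Measurable proj
  iid : iIndepFun Xd P
  law : ∀ i, Measure.map (Xd i) P = pstar
  cond : ∀ t, 1 ≤ t → ∀ A : Set Ω,
    MeasurableSet[MeasurableSpace.comap (ψit 0) inferInstance ⊔
      (⨆ i, MeasurableSpace.comap (Xd i) inferInstance) ⊔
      (⨆ s ∈ Set.Icc 1 (t - 1), ⨆ i, MeasurableSpace.comap (Xt s i) inferInstance)] A →
    ∀ B : Fin n → Set X, (∀ i, MeasurableSet (B i)) →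
      P (A ∩ ⋂ i, Xt t i ⁻¹' B i) =
        ∫⁻ ω in A, ∏ i, kIter (k (ψit (t - 1) ω)) m (Xd i ω) (B i) ∂P
  recur : ∀ t, 1 ≤ t →
    ψit t = fun ω =>
      proj (ψit (t - 1) ω - (C / n) • ∑ i, (φ (Xd i ω) - φ (Xt t i ω)))

theorem isMarkovKernel_kIter {X : Type*} [MeasurableSpace X] (κ : Kernel X X)
    [IsMarkovKernel κ] (m : ℕ) : IsMarkovKernel (kIter κ m) := by
  induction m with
  | zero => exact inferInstanceAs (IsMarkovKernel Kernel.id)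
  | succ m ih => exact inferInstanceAs (IsMarkovKernel (κ ∘ₖ kIter κ m))

theorem stronglyMeasurable_kMean {X : Type*} [MeasurableSpace X] {p : ℕ}
    (k : Vec p → Kernel X X) (hk : ∀ ψ, IsMarkovKernel (k ψ)) {φ : X → Vec p}
    (hφ : Measurable φ) (m : ℕ) (ψ : Vec p) : StronglyMeasurable (kMean k φ m ψ) := by
  have := hk ψ
  have := isMarkovKernel_kIter (k ψ) m
  exact hφ.stronglyMeasurable.integral_kernel

theorem norm_integral_sub_le_of_norm_sub_le {X E : Type*} [MeasurableSpace X]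
    [NormedAddCommGroup E] [NormedSpace ℝ E] [CompleteSpace E] {μ : Measure X}
    [IsProbabilityMeasure μ] {f : X → E} (hf : AEStronglyMeasurable f μ) {M : E} {r : ℝ}
    (h : ∀ x, ‖f x - M‖ ≤ r) : ‖∫ x, f x ∂μ - M‖ ≤ r := by
  have hfi : Integrable f μ := by
    refine Integrable.of_bound hf (r + ‖M‖) (Eventually.of_forall fun x => ?_)
    linarith [h x, norm_sub_norm_le (f x) M]
  calc ‖∫ x, f x ∂μ - M‖ = ‖∫ x, (f x - M) ∂μ‖ := by
        rw [integral_sub hfi (integrable_const M)]; simp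
    _ ≤ r * μ.real Set.univ :=
        norm_integral_le_of_norm_le_const (Eventually.of_forall h)
    _ = r := by simp

theorem norm_average_sub_le_of_norm_sub_le {E : Type*} [NormedAddCommGroup E]
    [NormedSpace ℝ E] {n : ℕ} (hn : 1 ≤ n) {v : Fin n → E} {M : E} {r : ℝ}
    (h : ∀ i, ‖v i - M‖ ≤ r) : ‖(n : ℝ)⁻¹ • ∑ i, v i - M‖ ≤ r := by
  have hn0 : (n : ℝ) ≠ 0 := by positivity
  have heq : (n : ℝ)⁻¹ • ∑ i, v i - M = (n : ℝ)⁻¹ • ∑ i, (v i - M) := by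
    rw [Finset.sum_sub_distrib, smul_sub]
    simp [← Nat.cast_smul_eq_nsmul ℝ, smul_smul, hn0]
  calc ‖(n : ℝ)⁻¹ • ∑ i, v i - M‖ = (n : ℝ)⁻¹ * ‖∑ i, (v i - M)‖ := by
        rw [heq, norm_smul, Real.norm_of_nonneg (by positivity)]
    _ ≤ (n : ℝ)⁻¹ * (n * r) := by
        gcongr
        exact (norm_sum_le_of_le _ fun i _ => h i).trans_eq (by simp)
    _ = r := by field_simp

theorem DeltaFn_le_of_norm_kMean_sub_le {X : Type*} [MeasurableSpace X] {p n : ℕ}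
    {Ω : Type*} {k : Vec p → Kernel X X} (hk : ∀ ψ, IsMarkovKernel (k ψ)) {φ : X → Vec p}
    (hφ : Measurable φ) {m : ℕ} {μ : Measure X} [IsProbabilityMeasure μ] (hn : 1 ≤ n)
    {Xd : Fin n → Ω → X} {θ : Ω → Vec p} {ω : Ω} {M : Vec p} {r : ℝ}
    (h : ∀ x, ‖kMean k φ m (θ ω) x - M‖ ≤ r) : DeltaFn k φ m μ Xd θ ω ≤ 2 * r := by
  have hmean : ‖gBar k φ m μ (θ ω) - M‖ ≤ r := norm_integral_sub_le_of_norm_sub_le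
    (stronglyMeasurable_kMean k hk hφ m (θ ω)).aestronglyMeasurable h
  have havg := norm_average_sub_le_of_norm_sub_le hn fun i => h (Xd i ω)
  rw [DeltaFn, ← sub_sub_sub_cancel_right _ _ M]
  exact (norm_sub_le _ _).trans (by linarith)

/-- Markov's inequality for a bounded (not necessarily measurable) function. -/
theorem toReal_measure_lt_le_div {Ω : Type*} [MeasurableSpace Ω] (P : Measure Ω)
    [IsProbabilityMeasure P] {f : Ω → ℝ} {b ϵ : ℝ} (hb : 0 ≤ b) (hϵ : 0 < ϵ)
    (h : ∀ ω, f ω ≤ b) : (P {ω | ϵ < f ω}).toReal ≤ b / ϵ := by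
  rcases lt_or_ge ϵ b with hlt | hge
  · exact (measureReal_le_one (μ := P)).trans ((one_le_div hϵ).2 hlt.le)
  · have hempty : {ω | ϵ < f ω} = ∅ :=
      Set.eq_empty_of_forall_notMem fun ω hω => absurd (hge.trans_lt hω) (h ω).not_gt
    rw [hempty]
    simpa using div_nonneg hb hϵ.le

theorem epsFn_le {X : Type*} [MeasurableSpace X] {p n : ℕ} {Ω : Type*} [MeasurableSpace Ω]
    {k : Vec p → Kernel X X} {φ : X → Vec p} {m : ℕ} {μ : Measure X} {Xd : Fin n → Ω → X}
    {P : Measure Ω} [IsProbabilityMeasure P] {ν κ b ϵ : ℝ} {θ : Ω → Vec p} (hν : 2 < ν)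
    (hκ : 0 ≤ κ) (hb : 0 ≤ b) (hϵ : 0 < ϵ) (h : ∀ ω, DeltaFn k φ m μ Xd θ ω ≤ b) :
    epsFn k φ m μ Xd P ν κ θ ϵ ≤ ϵ + κ * (b / ϵ) ^ ((ν - 2) / (2 * ν)) := by
  have hnn : 0 ≤ κ * (b / ϵ) ^ ((ν - 2) / (2 * ν)) := by positivity
  have hsq : (b / ϵ) ^ ((ν - 2) / ν) = ((b / ϵ) ^ ((ν - 2) / (2 * ν))) ^ 2 := by
    rw [← Real.rpow_mul_natCast (by positivity)]
    congr 1
    push_cast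
    field_simp
  have hP : (P {ω | ϵ < DeltaFn k φ m μ Xd θ ω}).toReal ^ ((ν - 2) / ν) ≤
      ((b / ϵ) ^ ((ν - 2) / (2 * ν))) ^ 2 := by
    rw [← hsq]
    exact Real.rpow_le_rpow ENNReal.toReal_nonneg (toReal_measure_lt_le_div P hb hϵ h)
      (div_nonneg (by linarith) (by linarith))
  refine Real.sqrt_le_iff.2 ⟨by positivity, ?_⟩
  calc _ ≤ ϵ ^ 2 + κ ^ 2 * ((b / ϵ) ^ ((ν - 2) / (2 * ν))) ^ 2 := by gcongr
    _ ≤ _ := by nlinarith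

theorem sInf_epsFn_le {X : Type*} [MeasurableSpace X] {p n : ℕ} {Ω : Type*}
    [MeasurableSpace Ω] {k : Vec p → Kernel X X} {φ : X → Vec p} {m : ℕ} {μ : Measure X}
    {Xd : Fin n → Ω → X} {P : Measure Ω} [IsProbabilityMeasure P] {ν κ b ϵ : ℝ}
    {θ : Ω → Vec p} (hν : 2 < ν) (hκ : 0 ≤ κ) (hb : 0 ≤ b) (hϵ : 0 < ϵ)
    (h : ∀ ω, DeltaFn k φ m μ Xd θ ω ≤ b) :
    sInf ((fun ϵ => epsFn k φ m μ Xd P ν κ θ ϵ) '' Set.Ioi (0 : ℝ)) ≤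
      ϵ + κ * (b / ϵ) ^ ((ν - 2) / (2 * ν)) := by
  refine (csInf_le ⟨0, ?_⟩ (Set.mem_image_of_mem _ hϵ)).trans (epsFn_le hν hκ hb hϵ h)
  rintro _ ⟨ϵ', -, rfl⟩
  exact Real.sqrt_nonneg _

/-- For `b = s`, the radius `s ^ ((ν - 2) / (3 * ν - 2))` balances the two terms of
`epsFn_le` (up to the factor `κ`). -/
theorem div_rpow_balance {s ν : ℝ} (hs : 0 < s) (hν : 2 < ν) :
    (s / s ^ ((ν - 2) / (3 * ν - 2))) ^ ((ν - 2) / (2 * ν)) =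
      s ^ ((ν - 2) / (3 * ν - 2)) := by
  have h3 : 3 * ν - 2 ≠ 0 := by linarith
  have hν0 : ν ≠ 0 := by linarith
  nth_rewrite 1 [← Real.rpow_one s]
  rw [← Real.rpow_sub hs, ← Real.rpow_mul hs.le]
  rw [one_sub_div h3, show 3 * ν - 2 - (ν - 2) = 2 * ν by ring, div_mul_div_comm,
    mul_comm (3 * ν - 2), mul_div_mul_left _ _ (mul_ne_zero two_ne_zero hν0)]

/-- tail control via Markov chain mixing.  If
`‖E[φ(K^m_ψ(x))] − E_{Y∼p_ψ}[φ(Y)]‖ ≤ C̃ α̃^m` uniformly, then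
`inf_{ϵ>0} ε_{n;ν}(θ; ϵ) ≤ (1 + 2^{(ν−2)/(2ν)} κ C̃^{(ν−2)/(2ν)}) α̃^{(ν−2)m/(3ν−2)}`. -/
theorem tail_control_mixing
    {d p : ℕ} {S : Set (EuclideanSpace ℝ (Fin d))} (c : Measure ↥S) (φ : ↥S → Vec p)
    (Ψ : Set (Vec p)) (ψstar : Vec p) (k : Vec p → Kernel ↥S ↥S)
    {Ω : Type*} [MeasurableSpace Ω] (P : Measure Ω) [IsProbabilityMeasure P]
    (n m : ℕ) (hn : 1 ≤ n) (ν κ αt Ct : ℝ)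
    (hν : 2 < ν) (hκ : 0 ≤ κ) (hαt0 : 0 ≤ αt) (hαt1 : αt < 1) (hCt : 0 < Ct)
    (hφ : Measurable φ) (hc : c ≠ 0) (hZ : Zfn c φ ψstar < ∞)
    (hconv : Convex ℝ Ψ) (hcomp : IsCompact Ψ) (hstar : ψstar ∈ interior Ψ)
    (hk : ∀ ψ, IsMarkovKernel (k ψ))
    (Xd : Fin n → Ω → ↥S) (hXd : ∀ i, Measurable (Xd i))
    (hiid : iIndepFun Xd P)
    (hlaw : ∀ i, Measure.map (Xd i) P = expMeas c φ ψstar)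
    (θ : Ω → Vec p) (hθ : Measurable θ) (hθΨ : ∀ ω, θ ω ∈ Ψ)
    (hA6 : A6 φ Ψ k m ν κ) (hA9 : A9 φ Ψ k m (expMeas c φ ψstar) ν κ)
    (hmix : ∀ ψ ∈ Ψ, ∀ x : ↥S,
      ‖kMean k φ m ψ x - ∫ y, φ y ∂(expMeas c φ ψ)‖ ≤ Ct * αt ^ m) :
    sInf ((fun ϵ => epsFn k φ m (expMeas c φ ψstar) Xd P ν κ θ ϵ) '' Set.Ioi (0 : ℝ)) ≤
      (1 + (2 : ℝ) ^ ((ν - 2) / (2 * ν)) * κ * Ct ^ ((ν - 2) / (2 * ν))) *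
        αt ^ ((ν - 2) * (m : ℝ) / (3 * ν - 2)) := by
  have : IsProbabilityMeasure (expMeas c φ ψstar) := by
    rw [← hlaw ⟨0, hn⟩]
    exact Measure.isProbabilityMeasure_map (hXd _).aemeasurable
  have hΔ : ∀ ω, DeltaFn k φ m (expMeas c φ ψstar) Xd θ ω ≤ 2 * (Ct * αt ^ m) := fun ω =>
    DeltaFn_le_of_norm_kMean_sub_le hk hφ hn (hmix (θ ω) (hθΨ ω))
  have hb : 0 ≤ 2 * (Ct * αt ^ m) := by positivity
  have hexp : αt ^ ((ν - 2) * (m : ℝ) / (3 * ν - 2)) =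
      (αt ^ m) ^ ((ν - 2) / (3 * ν - 2)) := by
    rw [← Real.rpow_natCast_mul hαt0]
    congr 1
    ring
  have ha : 0 < (ν - 2) / (3 * ν - 2) := div_pos (by linarith) (by linarith)
  have ha' : 0 < (ν - 2) / (2 * ν) := div_pos (by linarith) (by linarith)
  rw [hexp]
  rcases (pow_nonneg hαt0 m).eq_or_lt with hs | hs
  · rw [← hs, Real.zero_rpow ha.ne', mul_zero]
    refine le_of_forall_pos_le_add fun ϵ hϵ => ?_
    refine (sInf_epsFn_le hν hκ hb hϵ hΔ).trans_eq ?_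
    simp [← hs, Real.zero_rpow ha'.ne']
  · have hϵ : 0 < (αt ^ m) ^ ((ν - 2) / (3 * ν - 2)) := Real.rpow_pos_of_pos hs _
    refine (sInf_epsFn_le hν hκ hb hϵ hΔ).trans_eq ?_
    rw [← mul_assoc, mul_div_assoc, Real.mul_rpow (by positivity) (by positivity),
      Real.mul_rpow zero_le_two hCt.le, div_rpow_balance hs hν]
    ring

end CD
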